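/- arXiv:2311.11036 — 9 statements merged into one kernel-verified Lean document; each statement's English description precedes it below -/
import Mathlib

section
/- Let f : [0,1] → ℝ, let M₀ ∈ ℕ satisfy |f(x)| ≤ M₀ for all x ∈ [0,1], and let k₀, N₀ ∈ ℕ be such that for all x, y ∈ [0,1], |x − y| < 2^{−N₀} implies |f(x) − f(y)| < 2^{−(k₀+1)}. Then for every n ≥ 2^{2M₀ + 2N₀ + k₀ + 1} and every x ∈ (0,1), one has |f(x) − B_n(f, x)| ≤ 2^{−k₀}. -/
open Filter Set

/-- The n-th Bernstein polynomial of `f` evaluated at `x`: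
`B_n(f,x) = ∑_{k=0}^n f(k/n) C(n,k) x^k (1-x)^{n-k}`. -/
noncomputable def bern (f : ℝ → ℝ) (n : ℕ) (x : ℝ) : ℝ :=
  ∑ k ∈ Finset.range (n + 1),
    f ((k : ℝ) / (n : ℝ)) * (n.choose k : ℝ) * x ^ k * (1 - x) ^ (n - k)

/-- The weights `C(n,k) x^k (1-x)^{n-k}` sum to `1`. -/
lemma sum_bernstein_weights (n : ℕ) (x : ℝ) :
    ∑ k ∈ Finset.range (n + 1), (n.choose k : ℝ) * x ^ k * (1 - x) ^ (n - k) = 1 := by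
  simpa [bernsteinPolynomial, Polynomial.eval_finsetSum] using
    congrArg (Polynomial.eval x) (bernsteinPolynomial.sum ℝ n)

/-- The variance of the Bernstein weights. -/
lemma sum_sq_mul_bernstein_weights {n : ℕ} (hn : 0 < n) (x : ℝ) :
    ∑ k ∈ Finset.range (n + 1),
      (x - (k : ℝ) / n) ^ 2 * ((n.choose k : ℝ) * x ^ k * (1 - x) ^ (n - k)) =
        x * (1 - x) / n := by
  have hn' : (n : ℝ) ≠ 0 := by positivity
  have h := congrArg (Polynomial.eval x) (bernsteinPolynomial.variance ℝ n)
  simp only [bernsteinPolynomial, Polynomial.eval_finsetSum, nsmul_eq_mul, Polynomial.eval_mul,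
    Polynomial.eval_pow, Polynomial.eval_sub, Polynomial.eval_natCast, Polynomial.eval_X,
    Polynomial.eval_one] at h
  have h' : x * (1 - x) / n = (n * x * (1 - x)) / (n : ℝ) ^ 2 := by field_simp
  rw [h', ← h, Finset.sum_div]
  refine Finset.sum_congr rfl fun k _ => ?_
  field_simp

/-- A function bounded by `M` that oscillates by at most `ε` at scale `δ` has a quadratic modulus
of continuity. -/
lemma abs_sub_le_add_sq_of_bounded {f : ℝ → ℝ} {s : Set ℝ} {M ε δ : ℝ} (hδ : 0 < δ) (hε : 0 ≤ ε)
    (hM : ∀ x ∈ s, |f x| ≤ M)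
    (hU : ∀ x ∈ s, ∀ y ∈ s, |x - y| < δ → |f x - f y| < ε)
    {x y : ℝ} (hx : x ∈ s) (hy : y ∈ s) :
    |f x - f y| ≤ ε + 2 * M / δ ^ 2 * (x - y) ^ 2 := by
  have hM0 : 0 ≤ M := (abs_nonneg _).trans (hM x hx)
  rcases lt_or_ge |x - y| δ with h | h
  · have : 0 ≤ 2 * M / δ ^ 2 * (x - y) ^ 2 := by positivity
    linarith [hU x hx y hy h]
  · have hsq : δ ^ 2 ≤ (x - y) ^ 2 := by
      rw [← sq_abs (x - y)]
      gcongr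
    have : 2 * M ≤ 2 * M / δ ^ 2 * (x - y) ^ 2 := by
      rw [div_mul_eq_mul_div, le_div_iff₀ (by positivity)]
      gcongr
    linarith [abs_sub (f x) (f y), hM x hx, hM y hy]

/-- A quadratic modulus of continuity on `[0,1]` bounds the error of Bernstein approximation. -/
lemma abs_sub_bern_le {f : ℝ → ℝ} {ε C x : ℝ} {n : ℕ} (hn : 0 < n) (hx : x ∈ Set.Icc (0 : ℝ) 1)
    (hf : ∀ y ∈ Set.Icc (0 : ℝ) 1, |f x - f y| ≤ ε + C * (x - y) ^ 2) :
    |f x - bern f n x| ≤ ε + C * (x * (1 - x) / n) := by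
  have hn' : (0 : ℝ) < n := by exact_mod_cast hn
  set w : ℕ → ℝ := fun k => (n.choose k : ℝ) * x ^ k * (1 - x) ^ (n - k) with hw
  have hw0 : ∀ k, 0 ≤ w k := fun k => by
    have := hx.1
    have := sub_nonneg.2 hx.2
    positivity
  have hsum : ∑ k ∈ Finset.range (n + 1), w k = 1 := sum_bernstein_weights n x
  have hvar : ∑ k ∈ Finset.range (n + 1), (x - (k : ℝ) / n) ^ 2 * w k = x * (1 - x) / n :=
    sum_sq_mul_bernstein_weights hn x
  have hdiff : f x - bern f n x =
      ∑ k ∈ Finset.range (n + 1), (f x - f ((k : ℝ) / n)) * w k := by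
    simp only [sub_mul, Finset.sum_sub_distrib]
    rw [← Finset.mul_sum, hsum, mul_one]
    simp only [bern, hw, mul_assoc]
  calc |f x - bern f n x|
      ≤ ∑ k ∈ Finset.range (n + 1), |(f x - f ((k : ℝ) / n)) * w k| := by
        rw [hdiff]
        exact Finset.abs_sum_le_sum_abs _ _
    _ ≤ ∑ k ∈ Finset.range (n + 1), (ε * w k + C * ((x - (k : ℝ) / n) ^ 2 * w k)) := by
        refine Finset.sum_le_sum fun k hk => ?_
        have hkn : (k : ℝ) ≤ n := by
          exact_mod_cast Nat.lt_succ_iff.1 (Finset.mem_range.1 hk)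
        rw [abs_mul, abs_of_nonneg (hw0 k), ← mul_assoc C, ← add_mul]
        exact mul_le_mul_of_nonneg_right
          (hf _ ⟨by positivity, div_le_one_of_le₀ hkn hn'.le⟩) (hw0 k)
    _ = ε + C * (x * (1 - x) / n) := by
        rw [Finset.sum_add_distrib, ← Finset.mul_sum, ← Finset.mul_sum, hsum, hvar, mul_one]

theorem stmt0 (f : ℝ → ℝ) (M₀ k₀ N₀ : ℕ)
    (hM : ∀ x ∈ Set.Icc (0:ℝ) 1, |f x| ≤ (M₀ : ℝ))
    (hU : ∀ x ∈ Set.Icc (0:ℝ) 1, ∀ y ∈ Set.Icc (0:ℝ) 1,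
      |x - y| < 1 / 2 ^ N₀ → |f x - f y| < 1 / 2 ^ (k₀ + 1)) :
    ∀ n : ℕ, 2 ^ (2 * M₀ + 2 * N₀ + k₀ + 1) ≤ n →
      ∀ x ∈ Set.Ioo (0:ℝ) 1, |f x - bern f n x| ≤ 1 / 2 ^ k₀ := by
  intro n hn x hx
  have hn0 : 0 < n := (by positivity : 0 < 2 ^ (2 * M₀ + 2 * N₀ + k₀ + 1)).trans_le hn
  have hx' := Set.Ioo_subset_Icc_self hx
  refine (abs_sub_bern_le hn0 hx' fun y hy =>
    abs_sub_le_add_sq_of_bounded (by positivity) (by positivity) hM hU hx' hy).trans ?_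
  have hnR : (2 : ℝ) ^ (2 * M₀ + 2 * N₀ + k₀ + 1) ≤ n := by exact_mod_cast hn
  have hMpow : (M₀ : ℝ) ≤ 2 ^ (2 * M₀) := by
    exact_mod_cast (Nat.lt_two_pow_self (n := M₀)).le.trans
      (Nat.pow_le_pow_right two_pos (by omega))
  have hxx : x * (1 - x) ≤ 1 / 2 := by nlinarith [sq_nonneg (x - 1 / 2)]
  have hvar : 2 * (M₀ : ℝ) / (1 / 2 ^ N₀) ^ 2 * (x * (1 - x) / n) ≤ 1 / 2 ^ (k₀ + 1) :=
    calc 2 * (M₀ : ℝ) / (1 / 2 ^ N₀) ^ 2 * (x * (1 - x) / n)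
        ≤ 2 * (2 ^ (2 * M₀)) / (1 / 2 ^ N₀) ^ 2 *
            (1 / 2 / 2 ^ (2 * M₀ + 2 * N₀ + k₀ + 1)) := by
          have := mul_nonneg hx'.1 (sub_nonneg.2 hx'.2)
          gcongr
      _ = 1 / 2 ^ (k₀ + 1) := by
          field_simp
          ring
  have hhalf : (1 : ℝ) / 2 ^ k₀ = 1 / 2 ^ (k₀ + 1) + 1 / 2 ^ (k₀ + 1) := by
    field_simp
    ring
  linarith
end

section
/- For every x ∈ (0,1) and every δ > 0, lim_{n→∞} ∑_{k ∈ {0,…,n}, x ≤ k/n < x+δ} C(n,k) · x^k · (1 − x)^{n−k} = 1/2. -/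
open Filter Set

open MeasureTheory ProbabilityTheory Topology unitInterval

/-- The characteristic function of the binomial distribution. -/
lemma charFun_map_cast_binomial (n : ℕ) (p : I) (t : ℝ) :
    charFun Bin(ℝ, n, p) t = ((p : ℂ) * Complex.exp (t * Complex.I) + (1 - p)) ^ n := by
  rw [charFun_apply_real, integral_map_cast_binomial, add_pow, Nat.range_succ_eq_Iic]
  refine Finset.sum_congr rfl fun k _ ↦ ?_
  rw [Complex.real_smul, mul_pow, ← Complex.exp_nat_mul]
  push_cast
  ring_nf

/-- A sum of `n` independent Bernoulli random variables follows a binomial distribution. -/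
lemma map_sum_range_eq_binomial {Ω : Type*} {mΩ : MeasurableSpace Ω} {P : Measure Ω}
    [IsProbabilityMeasure P] {X : ℕ → Ω → ℝ} {p : I} (hX : ∀ i, HasLaw (X i) Ber(1, 0, p) P)
    (hindep : iIndepFun X P) (n : ℕ) :
    P.map (fun ω ↦ ∑ k ∈ Finset.range n, X k ω) = Bin(ℝ, n, p) := by
  have hmeas (i : ℕ) : AEMeasurable (X i) P := (hX i).aemeasurable
  have : IsProbabilityMeasure (P.map (fun ω ↦ ∑ k ∈ Finset.range n, X k ω)) :=
    Measure.isProbabilityMeasure_map (Finset.aemeasurable_fun_sum _ fun i _ ↦ hmeas i)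
  refine Measure.ext_of_charFun (funext fun t ↦ ?_)
  rw [(hindep.restrict _).charFun_map_fun_finsetSum_eq_prod (fun i _ ↦ hmeas i),
    charFun_map_cast_binomial]
  simp [(hX _).map_eq, charFun_apply_real, integral_bernoulliMeasure]

/-- A nondegenerate centered Gaussian gives mass one half to the nonnegative reals. -/
lemma gaussianReal_zero_real_Ici_zero {v : NNReal} (hv : v ≠ 0) :
    (gaussianReal 0 v).real (Ici 0) = 1 / 2 := by
  have := nullSingletonClass_gaussianReal (μ := 0) hv
  have hneg : (gaussianReal 0 v).real (Iio 0) = (gaussianReal 0 v).real (Ici 0) := by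
    have hmap : (gaussianReal 0 v).map (fun y ↦ -y) = gaussianReal 0 v := by
      simpa using gaussianReal_map_neg (μ := 0) (v := v)
    rw [measureReal_congr Iio_ae_eq_Iic]
    conv_lhs => rw [← hmap]
    rw [map_measureReal_apply measurable_neg measurableSet_Iic]
    simp
  have hcompl := probReal_compl_eq_one_sub (μ := gaussianReal 0 v)
    (measurableSet_Ici (a := (0 : ℝ)))
  rw [compl_Ici] at hcompl
  linarith

/-- The probability that a binomial variable is at least its mean tends to one half. -/
lemma tendsto_binomial_real_ge_mean {p : I} (h0 : 0 < p) (h1 : p < 1) :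
    Tendsto (fun n : ℕ ↦ Bin(ℝ, n, p).real (Ici (n * p))) atTop (𝓝 (1 / 2)) := by
  obtain ⟨Ω, _, P, X, -, hX, hindep, _⟩ := exists_iid ℕ (Ber((1 : ℝ), 0, p))
  have hmean : P[X 0] = (p : ℝ) := by
    rw [(hX 0).integral_eq, integral_bernoulliMeasure]
    simp
  have hident : IdentDistrib (X 0) id P Ber(1, 0, p) := ⟨(hX 0).aemeasurable, by fun_prop,
    by rw [(hX 0).map_eq, Measure.map_id]⟩
  have hmem : MemLp (X 0) 2 P := by
    rw [hident.memLp_iff, memLp_two_iff_integrable_sq (by fun_prop)]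
    exact integrable_bernoulliMeasure _ _ _ _
  have hvar : Var[X 0; P].toNNReal ≠ 0 := by
    have hp0 : (0 : ℝ) < p := h0
    have hp1 : (0 : ℝ) < 1 - p := sub_pos.2 h1
    have hsq : P[X 0 ^ 2] = (p : ℝ) := by
      have hcomp := (hX 0).integral_comp (f := fun y ↦ y ^ 2) (by fun_prop)
      rw [integral_bernoulliMeasure] at hcomp
      simpa using hcomp
    rw [variance_eq_sub hmem, hmean, hsq]
    simp only [ne_eq, Real.toNNReal_eq_zero, not_le]
    nlinarith [mul_pos hp0 hp1]
  have hclt := tendstoInDistribution_inv_sqrt_mul_sum_sub (P := P) (X := X)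
    (P' := gaussianReal 0 Var[X 0; P].toNNReal) (Y := id) .id hmem hindep
    fun i ↦ ⟨(hX i).aemeasurable, (hX 0).aemeasurable,
      (hX i).map_eq.trans (hX 0).map_eq.symm⟩
  have := nullSingletonClass_gaussianReal (μ := 0) hvar
  have hlim := ProbabilityMeasure.tendsto_measure_of_null_frontier_of_tendsto' hclt.tendsto
    (E := Ici 0) (by simp)
  have hlim' := (ENNReal.tendsto_toReal (by simp)).comp hlim
  simp only [Measure.map_id] at hlim'
  change Tendsto _ _ (𝓝 ((gaussianReal 0 Var[X 0; P].toNNReal).real (Ici 0))) at hlim'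
  rw [gaussianReal_zero_real_Ici_zero hvar] at hlim'
  refine hlim'.congr' ?_
  filter_upwards [eventually_gt_atTop 0] with n hn
  have hS : AEMeasurable (fun ω ↦ ∑ k ∈ Finset.range n, X k ω) P :=
    Finset.aemeasurable_fun_sum _ fun i _ ↦ (hX i).aemeasurable
  rw [← map_sum_range_eq_binomial hX hindep,
    map_measureReal_apply_of_aemeasurable hS measurableSet_Ici]
  simp only [Function.comp_apply, ProbabilityMeasure.coe_mk]
  rw [Measure.map_apply_of_aemeasurable (hclt.forall_aemeasurable n) measurableSet_Ici,
    ← measureReal_def]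
  congr 1
  ext ω
  have : 0 < (√n)⁻¹ := by positivity
  simp [hmean, this, mul_nonneg_iff_of_pos_left]

/-- The binomial distribution evaluated on a set of reals, as a finite sum. -/
lemma map_cast_binomial_real_apply (n : ℕ) (p : I) {A : Set ℝ}
    [DecidablePred fun k : ℕ ↦ (k : ℝ) ∈ A]
    (hA : MeasurableSet A) :
    Bin(ℝ, n, p).real A = ∑ k ∈ (Finset.range (n + 1)).filter (fun k : ℕ ↦ (k : ℝ) ∈ A),
      (n.choose k : ℝ) * (p : ℝ) ^ k * (1 - p) ^ (n - k) := by
  classical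
  rw [← integral_indicator_one hA, integral_map_cast_binomial, Finset.sum_filter,
    Nat.range_succ_eq_Iic]
  refine Finset.sum_congr rfl fun k _ ↦ ?_
  simp [Set.indicator_apply]

/-- Chebyshev's inequality for the upper tail of the binomial distribution. -/
lemma map_cast_binomial_real_Ici_le {n : ℕ} (hn : n ≠ 0) (p : I) {δ : ℝ} (hδ : 0 < δ) :
    Bin(ℝ, n, p).real (Ici (n * (p + δ))) ≤ (p : ℝ) * (1 - p) / n / δ ^ 2 := by
  classical
  rw [map_cast_binomial_real_apply n p measurableSet_Ici, ← bernstein.variance hn, Finset.sum_div,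
    Finset.sum_filter, Finset.sum_range]
  refine Finset.sum_le_sum fun k _ ↦ ?_
  have hb : 0 ≤ bernstein n k p := bernstein_nonneg
  split_ifs with h
  · rw [← bernstein_apply, le_div_iff₀ (by positivity), mul_comm]
    refine mul_le_mul_of_nonneg_right ?_ hb
    have hn' : (0 : ℝ) < n := by positivity
    have hk : p + δ ≤ (k : ℝ) / n := by
      rw [le_div_iff₀ hn', mul_comm]
      exact h
    have hz : (bernstein.z k : ℝ) = (k : ℝ) / n := rfl
    rw [hz]
    nlinarith
  · positivity

theorem stmt2 (x : ℝ) (hx : x ∈ Set.Ioo (0:ℝ) 1) (δ : ℝ) (hδ : 0 < δ) :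
    Filter.Tendsto (fun n : ℕ =>
        ∑ k ∈ (Finset.range (n + 1)).filter
            (fun k : ℕ => x ≤ (k : ℝ) / (n : ℝ) ∧ (k : ℝ) / (n : ℝ) < x + δ),
          (n.choose k : ℝ) * x ^ k * (1 - x) ^ (n - k))
      Filter.atTop (nhds (1 / 2)) := by
  classical
  lift x to I using ⟨hx.1.le, hx.2.le⟩
  have htail : Tendsto (fun n : ℕ ↦ Bin(ℝ, n, x).real (Ici (n * (x + δ)))) atTop (𝓝 0) := by
    refine squeeze_zero' (.of_forall fun _ ↦ measureReal_nonneg) ?_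
      (g := fun n : ℕ ↦ (x : ℝ) * (1 - x) / n / δ ^ 2) ?_
    · filter_upwards [eventually_ne_atTop 0] with n hn
      exact map_cast_binomial_real_Ici_le hn x hδ
    · simpa using (tendsto_const_div_atTop_nhds_zero_nat ((x : ℝ) * (1 - x))).div_const (δ ^ 2)
  have hlim := (tendsto_binomial_real_ge_mean (p := x) hx.1 hx.2).sub htail
  rw [sub_zero] at hlim
  refine hlim.congr' ?_
  filter_upwards [eventually_gt_atTop 0] with n hn
  have hn' : (0 : ℝ) < n := by positivity
  rw [← measureReal_sdiff (Ici_subset_Ici.2 (by gcongr; linarith)) measurableSet_Ici,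
    map_cast_binomial_real_apply n x (measurableSet_Ici.diff measurableSet_Ici)]
  refine Finset.sum_congr (Finset.filter_congr fun k _ ↦ ?_) fun _ _ ↦ rfl
  rw [le_div_iff₀ hn', div_lt_iff₀ hn', mul_comm _ (n : ℝ), mul_comm _ (n : ℝ)]
  simp
end

section
/- Let f : [0,1] → [0,1] and let x ∈ (0,1) be such that the right limit f(x+) := lim_{y→x⁺} f(y) and the left limit f(x−) := lim_{y→x⁻} f(y) both exist. Then lim_{n→∞} B_n(f, x) = (f(x+) + f(x−))/2. -/
open Filter Set

open MeasureTheory ProbabilityTheory Topology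

lemma bern_eq_integral_binomial (f : ℝ → ℝ) (n : ℕ) (p : unitInterval) :
    bern f n p = ∫ k : ℕ, f (k / n) ∂(binomial n p) := by
  rw [integral_binomial, bern, ← Nat.range_succ_eq_Iic]
  refine Finset.sum_congr rfl fun k _ ↦ ?_
  rw [smul_eq_mul]
  ring

lemma bern_add (f g : ℝ → ℝ) (n : ℕ) (x : ℝ) :
    bern (fun y ↦ f y + g y) n x = bern f n x + bern g n x := by
  simp only [bern, ← Finset.sum_add_distrib, add_mul]

lemma bern_const_mul (c : ℝ) (f : ℝ → ℝ) (n : ℕ) (x : ℝ) :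
    bern (fun y ↦ c * f y) n x = c * bern f n x := by
  simp only [bern, Finset.mul_sum, mul_assoc]

lemma bern_const (c : ℝ) (n : ℕ) (x : ℝ) : bern (fun _ ↦ c) n x = c := by
  have h := add_pow x (1 - x) n
  rw [add_sub_cancel, one_pow] at h
  calc bern (fun _ ↦ c) n x
      = c * ∑ k ∈ Finset.range (n + 1), x ^ k * (1 - x) ^ (n - k) * (n.choose k : ℝ) := by
        rw [bern, Finset.mul_sum]
        exact Finset.sum_congr rfl fun k _ ↦ by ring
    _ = c := by rw [← h, mul_one]

lemma bern_mono {f g : ℝ → ℝ} (h : ∀ y ∈ Icc (0 : ℝ) 1, f y ≤ g y) (n : ℕ) {x : ℝ}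
    (hx : x ∈ Icc (0 : ℝ) 1) : bern f n x ≤ bern g n x := by
  refine Finset.sum_le_sum fun k hk ↦ ?_
  have hk : (k : ℝ) ≤ n := by exact_mod_cast Finset.mem_range_succ_iff.1 hk
  have hx0 : 0 ≤ x := hx.1
  have hx1 : 0 ≤ 1 - x := sub_nonneg.2 hx.2
  gcongr
  exact h _ ⟨by positivity, div_le_one_of_le₀ hk (by positivity)⟩

/-- The variance of the binomial distribution, rescaled to `[0,1]`. -/
lemma bern_sq_sub {n : ℕ} (hn : n ≠ 0) {x : ℝ} (hx : x ∈ Icc (0 : ℝ) 1) :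
    bern (fun y ↦ (y - x) ^ 2) n x = x * (1 - x) / n := by
  rw [← bernstein.variance hn ⟨x, hx⟩, bern, Finset.sum_range]
  refine Finset.sum_congr rfl fun k _ ↦ ?_
  simp only [bernstein_apply, bernstein.z]
  ring

/-- Bernstein's theorem at a single point of continuity. -/
lemma tendsto_bern_of_continuousWithinAt {g : ℝ → ℝ} {x C : ℝ} (hx : x ∈ Icc (0 : ℝ) 1)
    (hC : ∀ y ∈ Icc (0 : ℝ) 1, |g y - g x| ≤ C) (hg : ContinuousWithinAt g (Icc 0 1) x) :
    Tendsto (fun n ↦ bern g n x) atTop (𝓝 (g x)) := by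
  rw [Metric.tendsto_atTop']
  intro ε hε
  obtain ⟨δ, hδ, hgδ⟩ := Metric.continuousWithinAt_iff.1 hg (ε / 2) (half_pos hε)
  have hC0 : 0 ≤ C := (abs_nonneg _).trans (hC x hx)
  have hbound : ∀ y ∈ Icc (0 : ℝ) 1, |g y - g x| ≤ ε / 2 + C / δ ^ 2 * (y - x) ^ 2 := by
    intro y hy
    rcases lt_or_ge |y - x| δ with h | h
    · have := hgδ hy (by rwa [Real.dist_eq])
      rw [Real.dist_eq] at this
      have : 0 ≤ C / δ ^ 2 * (y - x) ^ 2 := by positivity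
      linarith
    · have h2 : δ ^ 2 ≤ (y - x) ^ 2 := by
        rw [← sq_abs (y - x)]
        gcongr
      have : C ≤ C / δ ^ 2 * (y - x) ^ 2 := by
        rw [div_mul_eq_mul_div, le_div_iff₀ (by positivity)]
        gcongr
      linarith [hC y hy]
  have hlim : Tendsto (fun n : ℕ ↦ C / δ ^ 2 * (x * (1 - x) / n)) atTop (𝓝 0) := by
    simpa using (tendsto_const_div_atTop_nhds_zero_nat (x * (1 - x))).const_mul (C / δ ^ 2)
  obtain ⟨N, hN⟩ := eventually_atTop.1 (hlim.eventually_lt_const (half_pos hε))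
  refine ⟨N, fun n hn ↦ ?_⟩
  have hn0 : n ≠ 0 := by lia
  have key := hN n hn.le
  have hsq : bern (fun y ↦ ε / 2 + C / δ ^ 2 * (y - x) ^ 2) n x
      = ε / 2 + C / δ ^ 2 * (x * (1 - x) / n) := by
    rw [bern_add, bern_const, bern_const_mul, bern_sq_sub hn0 hx]
  have hupper := bern_mono (f := g)
    (g := fun y ↦ g x + (ε / 2 + C / δ ^ 2 * (y - x) ^ 2))
    (fun y hy ↦ by linarith [(abs_le.1 (hbound y hy)).2]) n hx
  have hlower := bern_mono (f := fun _ ↦ g x)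
    (g := fun y ↦ g y + (ε / 2 + C / δ ^ 2 * (y - x) ^ 2))
    (fun y hy ↦ by linarith [(abs_le.1 (hbound y hy)).1]) n hx
  rw [bern_add, bern_const, hsq] at hupper
  rw [bern_add, bern_const, hsq] at hlower
  rw [Real.dist_eq, abs_lt]
  constructor <;> linarith

/-- The characteristic function of a normalised binomial law is the corresponding power of that
of a normalised Bernoulli law. -/
lemma charFun_map_binomial (p : unitInterval) (s : ℝ) (n : ℕ) (t : ℝ) :
    charFun ((binomial n p).map fun k : ℕ ↦ (√n)⁻¹ * (((k : ℝ) - n * p) / s)) t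
      = charFun ((binomial 1 p).map fun k : ℕ ↦ ((k : ℝ) - p) / s) ((√n)⁻¹ * t) ^ n := by
  rw [charFun_apply_real, charFun_apply_real, integral_map (by fun_prop) (by fun_prop),
    integral_map (by fun_prop) (by fun_prop), integral_binomial, integral_binomial,
    ← Nat.range_succ_eq_Iic, ← Nat.range_succ_eq_Iic]
  simp only [Finset.sum_range_succ _ 1, Finset.sum_range_one]
  rw [add_comm ((_ : ℝ) • _), add_pow]
  refine Finset.sum_congr rfl fun k hk ↦ ?_
  obtain ⟨m, rfl⟩ := Nat.exists_eq_add_of_le (Finset.mem_range_succ_iff.1 hk)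
  simp only [Complex.real_smul, mul_pow, ← Complex.exp_nat_mul]
  have hexp : Complex.exp (↑t * ↑((√↑(k + m))⁻¹ * ((↑k - ↑(k + m) * ↑p) / s)) * Complex.I)
      = Complex.exp (k * (↑((√↑(k + m))⁻¹ * t) * ↑((↑(1 : ℕ) - (p : ℝ)) / s) * Complex.I))
        * Complex.exp (m * (↑((√↑(k + m))⁻¹ * t) * ↑((↑(0 : ℕ) - (p : ℝ)) / s) * Complex.I)) := by
    rw [← Complex.exp_add]
    congr 1
    push_cast
    ring
  rw [hexp, Nat.add_sub_cancel_left]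
  push_cast
  simp
  ring

lemma gaussianReal_Iio_zero_eq_Ioi_zero (v : NNReal) :
    gaussianReal 0 v (Iio 0) = gaussianReal 0 v (Ioi 0) := by
  have h := gaussianReal_map_neg (μ := 0) (v := v)
  rw [neg_zero] at h
  conv_lhs => rw [← h, Measure.map_apply (by fun_prop) measurableSet_Iio]
  congr 1
  ext
  simp

lemma gaussianReal_Ioi_zero {v : NNReal} (hv : v ≠ 0) : gaussianReal 0 v (Ioi 0) = 2⁻¹ := by
  have := nullSingletonClass_gaussianReal (μ := 0) hv
  have h := prob_add_prob_compl (μ := gaussianReal 0 v) (measurableSet_Ioi (a := (0 : ℝ)))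
  rw [compl_Ioi, ← measure_congr Iio_ae_eq_Iic, gaussianReal_Iio_zero_eq_Ioi_zero,
    ← two_mul] at h
  exact ENNReal.eq_inv_of_mul_eq_one_left (by rwa [mul_comm])

/-- De Moivre–Laplace: the rescaled binomial laws converge weakly to the standard Gaussian. -/
lemma tendsto_map_binomial_gaussianReal (p : unitInterval) (hp : (p : ℝ) ∈ Ioo (0 : ℝ) 1)
    {E : Set ℝ} (hE : gaussianReal 0 1 (frontier E) = 0) :
    Tendsto (fun n : ℕ ↦ (binomial n p).map
      (fun k : ℕ ↦ (√n)⁻¹ * (((k : ℝ) - n * p) / √(p * (1 - p)))) E) atTop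
      (𝓝 (gaussianReal 0 1 E)) := by
  have hv : 0 < (p : ℝ) * (1 - p) := mul_pos hp.1 (sub_pos.2 hp.2)
  let μ (n : ℕ) : ProbabilityMeasure ℝ := ⟨(binomial n p).map
    (fun k : ℕ ↦ (√n)⁻¹ * (((k : ℝ) - n * p) / √(p * (1 - p)))),
    Measure.isProbabilityMeasure_map (by fun_prop)⟩
  let γ : ProbabilityMeasure ℝ := ⟨gaussianReal 0 1, inferInstance⟩
  have hμ : Tendsto μ atTop (𝓝 γ) := by
    refine ProbabilityMeasure.tendsto_iff_tendsto_charFun.2 fun t ↦ ?_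
    have h := tendsto_charFun_inv_sqrt_mul_pow (P := binomial 1 p)
      (X := fun k : ℕ ↦ ((k : ℝ) - p) / √(p * (1 - p))) (by fun_prop) ?_ ?_ t
    · simpa [μ, γ, charFun_map_binomial, charFun_gaussianReal, neg_div] using h
    · rw [integral_binomial, ← Nat.range_succ_eq_Iic]
      simp [Finset.sum_range_succ]
      ring
    · rw [integral_binomial, ← Nat.range_succ_eq_Iic]
      simp [Finset.sum_range_succ, div_pow, Real.sq_sqrt hv.le]
      have hp0 : (p : ℝ) ≠ 0 := hp.1.ne'
      have hp1 : 1 - (p : ℝ) ≠ 0 := (sub_pos.2 hp.2).ne'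
      field_simp
      ring
  exact ProbabilityMeasure.tendsto_measure_of_null_frontier_of_tendsto' hμ hE

/-- The Bernstein polynomials of the indicator of a set `E` that looks like the cone `S` from `x`
converge at `x` to the Gaussian mass of `S`. -/
lemma tendsto_bern_indicator {x : ℝ} (hx : x ∈ Ioo (0 : ℝ) 1) {E S : Set ℝ}
    (hS : MeasurableSet S) (hES : ∀ y c : ℝ, 0 < c → (c * (y - x) ∈ S ↔ y ∈ E))
    (hSγ : gaussianReal 0 1 (frontier S) = 0) :
    Tendsto (fun n ↦ bern (E.indicator fun _ ↦ 1) n x) atTop (𝓝 ((gaussianReal 0 1).real S)) := by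
  obtain ⟨p, rfl⟩ : ∃ p : unitInterval, (p : ℝ) = x := ⟨⟨x, Ioo_subset_Icc_self hx⟩, rfl⟩
  have h := (ENNReal.tendsto_toReal (measure_ne_top _ _)).comp
    (tendsto_map_binomial_gaussianReal p hx hSγ)
  refine h.congr' ?_
  filter_upwards [eventually_gt_atTop 0] with n hn
  have hn' : (0 : ℝ) < n := by exact_mod_cast hn
  have hv : 0 < (p : ℝ) * (1 - p) := mul_pos hx.1 (sub_pos.2 hx.2)
  have hpre : (fun k : ℕ ↦ (√n)⁻¹ * (((k : ℝ) - n * p) / √(p * (1 - p)))) ⁻¹' S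
      = {k : ℕ | (k : ℝ) / n ∈ E} := by
    ext k
    rw [mem_preimage, mem_ofPred_eq, ← hES _ ((√n)⁻¹ * n / √(p * (1 - p))) (by positivity)]
    congr! 1
    field_simp
  rw [Function.comp_apply, Measure.map_apply (by fun_prop) hS, hpre, bern_eq_integral_binomial]
  exact (integral_indicator_one (μ := binomial n p) (s := {k : ℕ | (k : ℝ) / n ∈ E})
    .of_discrete).symm

lemma tendsto_bern_indicator_Ioi {x : ℝ} (hx : x ∈ Ioo (0 : ℝ) 1) :
    Tendsto (fun n ↦ bern ((Ioi x).indicator fun _ ↦ 1) n x) atTop (𝓝 (1 / 2)) := by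
  have := nullSingletonClass_gaussianReal (μ := 0) (v := 1) one_ne_zero
  have h := tendsto_bern_indicator hx (E := Ioi x) (measurableSet_Ioi (a := (0 : ℝ)))
    (fun y c hc ↦ by simp [hc]) (by simp)
  simpa [measureReal_def, gaussianReal_Ioi_zero] using h

lemma tendsto_bern_indicator_Iio {x : ℝ} (hx : x ∈ Ioo (0 : ℝ) 1) :
    Tendsto (fun n ↦ bern ((Iio x).indicator fun _ ↦ 1) n x) atTop (𝓝 (1 / 2)) := by
  have := nullSingletonClass_gaussianReal (μ := 0) (v := 1) one_ne_zero
  have h := tendsto_bern_indicator hx (E := Iio x) (measurableSet_Iio (a := (0 : ℝ)))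
    (fun y c hc ↦ by simp [mul_neg_iff, hc, hc.not_gt]) (by simp)
  simpa [measureReal_def, gaussianReal_Iio_zero_eq_Ioi_zero, gaussianReal_Ioi_zero] using h

/-- Subtracting its one-sided limits from `f` leaves a function that is continuous at `x`. -/
lemma continuousWithinAt_sub_one_sided_limits {f : ℝ → ℝ} {x Lp Lm : ℝ}
    (hx : x ∈ Ioo (0 : ℝ) 1) (hLp : Tendsto f (𝓝[Ioc x 1] x) (𝓝 Lp))
    (hLm : Tendsto f (𝓝[Ico 0 x] x) (𝓝 Lm)) :
    ContinuousWithinAt (fun y ↦ f y + (f x - Lp) * (Ioi x).indicator (fun _ ↦ 1) y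
      + (f x - Lm) * (Iio x).indicator (fun _ ↦ 1) y) (Icc 0 1) x := by
  have hsplit : Icc (0 : ℝ) 1 = Ico 0 x ∪ ({x} ∪ Ioc x 1) := by
    rw [singleton_union, Ioc_insert_left hx.2.le, Ico_union_Icc_eq_Icc hx.1.le hx.2.le]
  rw [hsplit, continuousWithinAt_union, continuousWithinAt_union]
  refine ⟨?_, continuousWithinAt_singleton, ?_⟩
  · have h : Tendsto (fun y ↦ f y + (f x - Lm)) (𝓝[Ico 0 x] x) (𝓝 (Lm + (f x - Lm))) :=
      hLm.add_const _
    rw [add_sub_cancel] at h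
    simp only [ContinuousWithinAt, lt_self_iff_false, mem_Ioi, mem_Iio, not_false_eq_true,
      indicator_of_notMem, mul_zero, add_zero]
    refine h.congr' ?_
    filter_upwards [self_mem_nhdsWithin] with y hy
    simp [hy.2, hy.2.not_gt]
  · have h : Tendsto (fun y ↦ f y + (f x - Lp)) (𝓝[Ioc x 1] x) (𝓝 (Lp + (f x - Lp))) :=
      hLp.add_const _
    rw [add_sub_cancel] at h
    simp only [ContinuousWithinAt, lt_self_iff_false, mem_Ioi, mem_Iio, not_false_eq_true,
      indicator_of_notMem, mul_zero, add_zero]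
    refine h.congr' ?_
    filter_upwards [self_mem_nhdsWithin] with y hy
    simp [hy.1, hy.1.not_gt]

theorem stmt3 (f : ℝ → ℝ) (hf : ∀ x ∈ Set.Icc (0:ℝ) 1, f x ∈ Set.Icc (0:ℝ) 1)
    (x : ℝ) (hx : x ∈ Set.Ioo (0:ℝ) 1) (Lp Lm : ℝ)
    (hLp : Filter.Tendsto f (nhdsWithin x (Set.Ioc x 1)) (nhds Lp))
    (hLm : Filter.Tendsto f (nhdsWithin x (Set.Ico 0 x)) (nhds Lm)) :
    Filter.Tendsto (fun n => bern f n x) Filter.atTop (nhds ((Lp + Lm) / 2)) := by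
  have hxI := Ioo_subset_Icc_self hx
  have hg := tendsto_bern_of_continuousWithinAt (C := 1 + |f x - Lp| + |f x - Lm|) hxI ?_
    (continuousWithinAt_sub_one_sided_limits hx hLp hLm)
  · have h := (hg.sub ((tendsto_bern_indicator_Ioi hx).const_mul (f x - Lp))).sub
      ((tendsto_bern_indicator_Iio hx).const_mul (f x - Lm))
    simp only [bern_add, bern_const_mul] at h
    convert h using 2
    · ring
    · simp
      ring
  · intro y hy
    have hfy : |f y - f x| ≤ 1 := by
      have h1 := hf y hy
      have h2 := hf x hxI
      rw [abs_le]
      constructor <;> linarith [h1.1, h1.2, h2.1, h2.2]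
    have hind (c : ℝ) (s : Set ℝ) : |c * s.indicator (fun _ ↦ 1) y| ≤ |c| := by
      by_cases hs : y ∈ s <;> simp [hs]
    calc _ = |(f y - f x) + (f x - Lp) * (Ioi x).indicator (fun _ ↦ 1) y
          + (f x - Lm) * (Iio x).indicator (fun _ ↦ 1) y| := by
          congr 1
          simp
          ring
      _ ≤ _ := (abs_add_three _ _ _).trans
          (add_le_add (add_le_add hfy (hind _ _)) (hind _ _))
end

section
/- Let f : [0,1] → ℝ be regulated. Then the set { x ∈ (0,1) : it is not the case that lim_{n→∞} B_n(f, x) exists and equals f(x) } is countable. -/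
open Filter Set

/-- `f : [0,1] → ℝ` is regulated. -/
def Regulated (f : ℝ → ℝ) : Prop :=
  (∀ x ∈ Set.Ico (0:ℝ) 1, ∃ L : ℝ, Filter.Tendsto f (nhdsWithin x (Set.Ioc x 1)) (nhds L)) ∧
  (∀ x ∈ Set.Ioc (0:ℝ) 1, ∃ L : ℝ, Filter.Tendsto f (nhdsWithin x (Set.Ico 0 x)) (nhds L))

open Topology

/-- A function on `[0,1]` with one-sided limits has right limits along `𝓝[>]`. -/
lemma Regulated.exists_tendsto_nhdsGT {f : ℝ → ℝ} (hf : Regulated f) {x : ℝ}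
    (hx : x ∈ Ico (0 : ℝ) 1) : ∃ L, Tendsto f (𝓝[>] x) (𝓝 L) := by
  simpa only [nhdsWithin_Ioc_eq_nhdsGT hx.2] using hf.1 x hx

/-- A function on `[0,1]` with one-sided limits has left limits along `𝓝[<]`. -/
lemma Regulated.exists_tendsto_nhdsLT {f : ℝ → ℝ} (hf : Regulated f) {x : ℝ}
    (hx : x ∈ Ioc (0 : ℝ) 1) : ∃ L, Tendsto f (𝓝[<] x) (𝓝 L) := by
  simpa only [nhdsWithin_Ico_eq_nhdsLT hx.1] using hf.2 x hx

/-- A regulated function is bounded on `[0,1]`. -/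
lemma Regulated.exists_bound {f : ℝ → ℝ} (hf : Regulated f) :
    ∃ C, ∀ x ∈ Icc (0 : ℝ) 1, |f x| ≤ C := by
  refine isCompact_Icc.induction_on (p := fun s => ∃ C, ∀ x ∈ s, |f x| ≤ C) ⟨0, by simp⟩
    (fun s t hst ⟨C, hC⟩ => ⟨C, fun x hx => hC x (hst hx)⟩) ?_ ?_
  · rintro s t ⟨C, hC⟩ ⟨D, hD⟩
    refine ⟨max C D, ?_⟩
    rintro x (hx | hx)
    · exact le_max_of_le_left (hC x hx)
    · exact le_max_of_le_right (hD x hx)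
  · intro p hp
    have bound_of_tendsto : ∀ {l : Filter ℝ} {L : ℝ}, Tendsto f l (𝓝 L) →
        ∀ᶠ y in l, |f y| ≤ |L| + 1 := fun h =>
      (h.abs.eventually_lt_const (lt_add_one _)).mono fun _ => le_of_lt
    have right : ∃ C, ∀ᶠ y in 𝓝[>] p, y ∈ Icc (0 : ℝ) 1 → |f y| ≤ C := by
      rcases hp.2.lt_or_eq with h | rfl
      · obtain ⟨L, hL⟩ := hf.exists_tendsto_nhdsGT ⟨hp.1, h⟩
        exact ⟨_, (bound_of_tendsto hL).mono fun _ h _ => h⟩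
      · refine ⟨0, ?_⟩
        filter_upwards [self_mem_nhdsWithin] with y hy hy'
        exact absurd hy'.2 (not_le.2 hy)
    have left : ∃ C, ∀ᶠ y in 𝓝[<] p, y ∈ Icc (0 : ℝ) 1 → |f y| ≤ C := by
      rcases hp.1.lt_or_eq with h | rfl
      · obtain ⟨L, hL⟩ := hf.exists_tendsto_nhdsLT ⟨h, hp.2⟩
        exact ⟨_, (bound_of_tendsto hL).mono fun _ h _ => h⟩
      · refine ⟨0, ?_⟩
        filter_upwards [self_mem_nhdsWithin] with y hy hy'
        exact absurd hy'.1 (not_le.2 hy)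
    obtain ⟨C, hC⟩ := right
    obtain ⟨D, hD⟩ := left
    have punctured : ∀ᶠ y in 𝓝[≠] p, y ∈ Icc (0 : ℝ) 1 → |f y| ≤ max C D := by
      rw [← nhdsLT_sup_nhdsGT, eventually_sup]
      exact ⟨hD.mono fun y h hy => le_max_of_le_right (h hy),
        hC.mono fun y h hy => le_max_of_le_left (h hy)⟩
    rw [eventually_nhdsWithin_iff] at punctured
    refine ⟨{y | |f y| ≤ max (max C D) |f p|}, ?_, max (max C D) |f p|, fun _ h => h⟩
    filter_upwards [self_mem_nhdsWithin, mem_nhdsWithin_of_mem_nhds punctured] with y hy hy'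
    by_cases hyp : y = p
    · subst hyp; exact le_max_right _ _
    · exact le_max_of_le_left (hy' hyp hy)

/-- If `f` has a limit along `𝓝[s] p` with `s` open, then near `p` within `s` the oscillation of
`f` is small. -/
lemma eventually_nhdsWithin_eventually_abs_sub_lt {f : ℝ → ℝ} {s : Set ℝ} {p L ε : ℝ}
    (hs : IsOpen s) (hL : Tendsto f (𝓝[s] p) (𝓝 L)) (hε : 0 < ε) :
    ∀ᶠ x in 𝓝[s] p, ∀ᶠ y in 𝓝 x, |f y - f x| < ε := by
  have h : ∀ᶠ y in 𝓝[s] p, |f y - L| < ε / 2 := Metric.tendsto_nhds.1 hL _ (half_pos hε)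
  filter_upwards [eventually_eventually_nhdsWithin.2 h, h, self_mem_nhdsWithin] with x hx hxL hxs
  rw [hs.nhdsWithin_eq hxs] at hx
  filter_upwards [hx] with y hy
  rw [abs_lt] at *
  constructor <;> linarith [hy.1, hy.2, hxL.1, hxL.2]

/-- A regulated function has countably many points of oscillation at least `ε` in `(0,1)`. -/
lemma Regulated.countable_setOf_oscillation {f : ℝ → ℝ} (hf : Regulated f) {ε : ℝ} (hε : 0 < ε) :
    {x ∈ Ioo (0 : ℝ) 1 | ¬ ∀ᶠ y in 𝓝 x, |f y - f x| < ε}.Countable := by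
  set D := {x ∈ Ioo (0 : ℝ) 1 | ¬ ∀ᶠ y in 𝓝 x, |f y - f x| < ε}
  suffices (D ∩ Icc 0 1).Countable from
    this.mono (subset_inter subset_rfl fun x hx => Ioo_subset_Icc_self hx.1)
  refine isCompact_Icc.induction_on (p := fun s => (D ∩ s).Countable) (by simp)
    (fun s t hst ht => ht.mono (inter_subset_inter_right _ hst)) ?_ ?_
  · intro s t hs ht
    rw [inter_union_distrib_left]
    exact hs.union ht
  · intro p hp
    have right : ∀ᶠ x in 𝓝[>] p, x ∉ D := by
      rcases hp.2.lt_or_eq with h | rfl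
      · obtain ⟨L, hL⟩ := hf.exists_tendsto_nhdsGT ⟨hp.1, h⟩
        exact (eventually_nhdsWithin_eventually_abs_sub_lt isOpen_Ioi hL hε).mono
          fun _ h hx => hx.2 h
      · filter_upwards [self_mem_nhdsWithin] with x hx hx'
        exact lt_asymm hx'.1.2 hx
    have left : ∀ᶠ x in 𝓝[<] p, x ∉ D := by
      rcases hp.1.lt_or_eq with h | rfl
      · obtain ⟨L, hL⟩ := hf.exists_tendsto_nhdsLT ⟨h, hp.2⟩
        exact (eventually_nhdsWithin_eventually_abs_sub_lt isOpen_Iio hL hε).mono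
          fun _ h hx => hx.2 h
      · filter_upwards [self_mem_nhdsWithin] with x hx hx'
        exact lt_asymm hx'.1.1 hx
    have punctured : ∀ᶠ x in 𝓝[≠] p, x ∉ D := by
      rw [← nhdsLT_sup_nhdsGT, eventually_sup]
      exact ⟨left, right⟩
    rw [eventually_nhdsWithin_iff] at punctured
    refine ⟨_, mem_nhdsWithin_of_mem_nhds punctured, (countable_singleton p).mono ?_⟩
    rintro x ⟨hxD, hx⟩
    by_contra hxp
    exact hx hxp hxD

/-- A regulated function has countably many discontinuities in `(0,1)`. -/
lemma Regulated.countable_not_continuousAt {f : ℝ → ℝ} (hf : Regulated f) :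
    {x ∈ Ioo (0 : ℝ) 1 | ¬ ContinuousAt f x}.Countable := by
  refine (countable_iUnion fun m : ℕ =>
    hf.countable_setOf_oscillation (Nat.one_div_pos_of_nat (α := ℝ) (n := m))).mono ?_
  rintro x ⟨hx, hxf⟩
  by_contra hcon
  simp only [mem_iUnion, mem_ofPred_eq, not_exists, not_and, not_not] at hcon
  refine hxf (Metric.tendsto_nhds.2 fun ε hε => ?_)
  obtain ⟨m, hm⟩ := exists_nat_one_div_lt hε
  exact (hcon m hx).mono fun y hy => hy.trans hm

lemma bern_eq_sum_bernstein (f : ℝ → ℝ) (n : ℕ) (x : unitInterval) :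
    bern f n x = ∑ k : Fin (n + 1), f (bernstein.z k) * bernstein n k x := by
  simp only [bern, Finset.sum_range, bernstein_apply, bernstein.z, mul_assoc]

/-- Bernstein polynomials of a bounded function converge at every point of continuity. -/
lemma tendsto_bern_of_continuousAt {f : ℝ → ℝ} {C : ℝ} (hC : ∀ y ∈ Icc (0 : ℝ) 1, |f y| ≤ C)
    {x : ℝ} (hx : x ∈ Icc (0 : ℝ) 1) (hf : ContinuousAt f x) :
    Tendsto (fun n => bern f n x) atTop (𝓝 (f x)) := by
  rw [Metric.tendsto_nhds]
  intro ε hε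
  obtain ⟨δ, hδ, hδf⟩ := Metric.continuousAt_iff.1 hf (ε / 2) (half_pos hε)
  have hC₀ : 0 ≤ C := (abs_nonneg _).trans (hC x hx)
  set M := 2 * C / δ ^ 2 with hM
  have hM₀ : 0 ≤ M := by positivity
  have key : ∀ y ∈ Icc (0 : ℝ) 1, |f y - f x| ≤ ε / 2 + M * (x - y) ^ 2 := by
    intro y hy
    rcases lt_or_ge (dist y x) δ with h | h
    · exact (hδf h).le.trans (le_add_of_nonneg_right (by positivity))
    · have hsq : δ ^ 2 ≤ (x - y) ^ 2 := by
        rw [dist_comm, Real.dist_eq] at h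
        simpa only [sq_abs] using pow_le_pow_left₀ hδ.le h 2
      calc |f y - f x| ≤ |f y| + |f x| := abs_sub _ _
        _ ≤ 2 * C := by linarith [hC y hy, hC x hx]
        _ = M * δ ^ 2 := by rw [hM]; field_simp
        _ ≤ M * (x - y) ^ 2 := by gcongr
        _ ≤ ε / 2 + M * (x - y) ^ 2 := by linarith
  filter_upwards [(tendsto_const_div_atTop_nhds_zero_nat M).eventually_lt_const (half_pos hε),
    eventually_ne_atTop 0] with n hn hn₀
  lift x to unitInterval using hx
  calc |bern f n x - f x|
      = |∑ k : Fin (n + 1), (f (bernstein.z k) - f x) * bernstein n k x| := by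
        simp only [sub_mul, Finset.sum_sub_distrib, ← Finset.mul_sum, bernstein.probability,
          mul_one, bern_eq_sum_bernstein]
    _ ≤ ∑ k : Fin (n + 1), |f (bernstein.z k) - f x| * bernstein n k x := by
        refine (Finset.abs_sum_le_sum_abs _ _).trans_eq (Finset.sum_congr rfl fun k _ => ?_)
        rw [abs_mul, abs_of_nonneg bernstein_nonneg]
    _ ≤ ∑ k : Fin (n + 1),
          (ε / 2 + M * ((x : ℝ) - (bernstein.z k : unitInterval)) ^ 2) * bernstein n k x := by
        gcongr with k
        exact key _ (bernstein.z k).2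
    _ = ε / 2 + M * (x * (1 - x) / n) := by
        simp only [add_mul, Finset.sum_add_distrib, ← Finset.mul_sum, mul_assoc,
          bernstein.probability, bernstein.variance hn₀, mul_one]
    _ ≤ ε / 2 + M / n := by
        have : (x : ℝ) * (1 - x) ≤ 1 := by nlinarith [x.2.1, x.2.2]
        rw [← mul_div_assoc]
        gcongr
        exact mul_le_of_le_one_right hM₀ this
    _ < ε := by linarith

theorem stmt6 (f : ℝ → ℝ) (hf : Regulated f) :
    {x ∈ Set.Ioo (0:ℝ) 1 |
      ¬ Filter.Tendsto (fun n => bern f n x) Filter.atTop (nhds (f x))}.Countable := by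
  obtain ⟨C, hC⟩ := hf.exists_bound
  refine hf.countable_not_continuousAt.mono ?_
  rintro x ⟨hx, hxf⟩
  exact ⟨hx, fun h => hxf (tendsto_bern_of_continuousAt hC (Ioo_subset_Icc_self hx) h)⟩
end

section
/- (Helly's selection theorem) Let M ≥ 0 and let (f_n)_{n∈ℕ} be a sequence of functions from [0,1] to [0,1] such that V(f_n) ≤ M for all n ∈ ℕ. Then there is a subsequence (f_{n_j})_{j∈ℕ} converging pointwise on [0,1] to a function f : [0,1] → [0,1] of bounded variation. -/
open Filter Set

/-- A uniformly bounded sequence of monotone functions on the real line has a pointwise convergent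
subsequence. -/
theorem exists_subseq_tendsto_of_monotone {a b : ℝ} {u : ℕ → ℝ → ℝ} (hu : ∀ n, Monotone (u n))
    (hab : ∀ n x, u n x ∈ Icc a b) :
    ∃ φ : ℕ → ℕ, StrictMono φ ∧ ∃ g : ℝ → ℝ,
      ∀ x, Tendsto (fun j => u (φ j) x) atTop (nhds (g x)) := by
  have hlim : ∀ x, ∃ y, Tendsto (fun n => u n x) (hyperfilter ℕ : Filter ℕ) (nhds y) := by
    intro x
    obtain ⟨y, -, hy⟩ := isCompact_Icc.ultrafilter_le_nhds
      ((hyperfilter ℕ).map fun n => u n x)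
      (le_principal_iff.2 <| mem_map.2 <| Eventually.of_forall fun n => hab n x)
    exact ⟨y, hy⟩
  choose g hg using hlim
  have hgm : Monotone g := fun x y hxy =>
    le_of_tendsto_of_tendsto' (hg x) (hg y) fun n => hu n hxy
  -- Pointwise convergence on a countable dense set containing the discontinuities of the
  -- ultrafilter limit suffices.
  let S : Set ℝ := {x | ¬ ContinuousAt g x} ∪ range ((↑) : ℚ → ℝ)
  have hS : S.Countable := hgm.countable_not_continuousAt.union (countable_range _)
  have : Countable S := hS.to_subtype
  have hcl : MapClusterPt (S.domRestrict g) atTop (fun n => S.domRestrict (u n)) :=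
    (Tendsto.mapClusterPt (tendsto_pi_nhds.2 fun s : S => hg s)).mono Nat.hyperfilter_le_atTop
  obtain ⟨φ, hφ, hφlim⟩ := hcl.tendsto_subseq
  have hφS : ∀ s ∈ S, Tendsto (fun j => u (φ j) s) atTop (nhds (g s)) := fun s hs =>
    tendsto_pi_nhds.1 hφlim ⟨s, hs⟩
  refine ⟨φ, hφ, g, fun x => ?_⟩
  by_cases hx : ContinuousAt g x
  · refine tendsto_order.2 ⟨fun c hc => ?_, fun c hc => ?_⟩
    · obtain ⟨l, hl, hlc⟩ := exists_Ioc_subset_of_mem_nhds (hx.eventually_const_lt hc)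
        (exists_lt x)
      obtain ⟨q, hlq, hqx⟩ := exists_rat_btwn hl
      filter_upwards [(hφS q (Or.inr ⟨q, rfl⟩)).eventually_const_lt (hlc ⟨hlq, hqx.le⟩)]
        with j hj using hj.trans_le (hu _ hqx.le)
    · obtain ⟨r, hr, hrc⟩ := exists_Ico_subset_of_mem_nhds (hx.eventually_lt_const hc)
        (exists_gt x)
      obtain ⟨q, hxq, hqr⟩ := exists_rat_btwn hr
      filter_upwards [(hφS q (Or.inr ⟨q, rfl⟩)).eventually_lt_const (hrc ⟨hxq.le, hqr⟩)]
        with j hj using (hu _ hxq.le).trans_lt hj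
  · exact hφS x (Or.inl hx)

/-- A uniformly bounded sequence of functions on the real line of uniformly bounded variation has
a pointwise convergent subsequence. -/
theorem exists_subseq_tendsto_of_eVariationOn_le {a b M : ℝ} (hM : 0 ≤ M) {f : ℕ → ℝ → ℝ}
    (hab : ∀ n x, f n x ∈ Icc a b)
    (hV : ∀ n, eVariationOn (f n) univ ≤ ENNReal.ofReal M) :
    ∃ φ : ℕ → ℕ, StrictMono φ ∧ ∃ g : ℝ → ℝ,
      ∀ x, Tendsto (fun j => f (φ j) x) atTop (nhds (g x)) := by
  have hbv : ∀ n, BoundedVariationOn (f n) univ := fun n =>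
    ((hV n).trans_lt ENNReal.ofReal_lt_top).ne
  let p : ℕ → ℝ → ℝ := fun n => variationOnFromTo (f n) univ 0
  have hp : ∀ n x, p n x ∈ Icc (-M) M := fun n x =>
    abs_le.1 <| (variationOnFromTo.abs_le_eVariationOn (hbv n)).trans
      (ENNReal.toReal_le_of_le_ofReal hM (hV n))
  have hpm : ∀ n, Monotone (p n) := fun n => monotoneOn_univ.1 <|
    variationOnFromTo.monotoneOn (hbv n).locallyBoundedVariationOn (mem_univ 0)
  have hqm : ∀ n, Monotone (p n - f n) := fun n => monotoneOn_univ.1 <|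
    variationOnFromTo.sub_self_monotoneOn (hbv n).locallyBoundedVariationOn (mem_univ 0)
  obtain ⟨φ, hφ, g, hg⟩ := exists_subseq_tendsto_of_monotone hpm hp
  obtain ⟨ψ, hψ, h, hh⟩ := exists_subseq_tendsto_of_monotone (fun n => hqm (φ n))
    (a := -M - b) (b := M - a) fun n x =>
      ⟨sub_le_sub (hp _ x).1 (hab _ x).2, sub_le_sub (hp _ x).2 (hab _ x).1⟩
  refine ⟨φ ∘ ψ, hφ.comp hψ, g - h, fun x => ?_⟩
  simpa using ((hg x).comp hψ.tendsto_atTop).sub (hh x)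

theorem stmt12 (M : ℝ) (hM : 0 ≤ M) (f : ℕ → ℝ → ℝ)
    (hrange : ∀ n : ℕ, ∀ x ∈ Set.Icc (0:ℝ) 1, f n x ∈ Set.Icc (0:ℝ) 1)
    (hV : ∀ n : ℕ, eVariationOn (f n) (Set.Icc 0 1) ≤ ENNReal.ofReal M) :
    ∃ φ : ℕ → ℕ, StrictMono φ ∧ ∃ g : ℝ → ℝ,
      (∀ x ∈ Set.Icc (0:ℝ) 1, g x ∈ Set.Icc (0:ℝ) 1) ∧
      (∀ x ∈ Set.Icc (0:ℝ) 1,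
        Filter.Tendsto (fun j => f (φ j) x) Filter.atTop (nhds (g x))) ∧
      BoundedVariationOn g (Set.Icc 0 1) := by
  let π : ℝ → ℝ := fun x => projIcc (0 : ℝ) 1 zero_le_one x
  have hπ : ∀ x, π x ∈ Icc (0 : ℝ) 1 := fun x => (projIcc (0 : ℝ) 1 zero_le_one x).2
  have hπm : Monotone π := fun x y hxy => monotone_projIcc zero_le_one hxy
  obtain ⟨φ, hφ, g, hg⟩ := exists_subseq_tendsto_of_eVariationOn_le hM
    (f := fun n => f n ∘ π) (fun n x => hrange n _ (hπ x)) fun n =>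
      (eVariationOn.comp_le_of_monotoneOn (f n) π (hπm.monotoneOn univ)
        fun x _ => hπ x).trans (hV n)
  have hlim : ∀ x ∈ Icc (0 : ℝ) 1, Tendsto (fun j => f (φ j) x) atTop (nhds (g x)) := by
    intro x hx
    have hπx : π x = x := congrArg Subtype.val (projIcc_of_mem zero_le_one hx)
    simpa [hπx] using hg x
  refine ⟨φ, hφ, g, fun x hx => isClosed_Icc.mem_of_tendsto (hlim x hx)
    (Eventually.of_forall fun j => hrange _ x hx), hlim, ne_top_of_le_ne_top
    (ENNReal.ofReal_ne_top (r := M)) (le_of_not_gt fun hlt => ?_)⟩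
  obtain ⟨j, hj⟩ := (eVariationOn.lowerSemicontinuous_aux hlim hlt).exists
  exact (hV (φ j)).not_gt hj
end

section
/- Let A ⊆ [0,1] and let H : A → ℕ be a height function, i.e. for every n ∈ ℕ the set { x ∈ A : H(x) < n } is finite. Define g : [0,1] → ℝ by g(x) := 2^{−(H(x)+1)} for x ∈ A and g(x) := 0 for x ∉ A. Then for every x ∈ (0,1), lim_{n→∞} B_n(g, x) = 0; in particular lim_{n→∞} B_n(g, x) ≠ g(x) for every x ∈ A ∩ (0,1). -/
open Filter Set

lemma eval_bernsteinPolynomial (n k : ℕ) (x : ℝ) :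
    (bernsteinPolynomial ℝ n k).eval x = (n.choose k : ℝ) * x ^ k * (1 - x) ^ (n - k) := by
  simp [bernsteinPolynomial]

lemma eval_bernsteinPolynomial_nonneg (n k : ℕ) {x : ℝ} (hx : x ∈ Icc (0 : ℝ) 1) :
    0 ≤ (bernsteinPolynomial ℝ n k).eval x := by
  rw [eval_bernsteinPolynomial]
  have := hx.1
  have := sub_nonneg.2 hx.2
  positivity

lemma sum_eval_bernsteinPolynomial (n : ℕ) (x : ℝ) :
    ∑ k ∈ Finset.range (n + 1), (bernsteinPolynomial ℝ n k).eval x = 1 := by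
  rw [← Polynomial.eval_finsetSum, bernsteinPolynomial.sum, Polynomial.eval_one]

lemma sum_sq_mul_eval_bernsteinPolynomial (n : ℕ) (x : ℝ) :
    ∑ k ∈ Finset.range (n + 1), (n * x - k) ^ 2 * (bernsteinPolynomial ℝ n k).eval x =
      n * x * (1 - x) := by
  have h := congrArg (Polynomial.eval x) (bernsteinPolynomial.variance (R := ℝ) n)
  simpa [Polynomial.eval_finsetSum, mul_assoc] using h

/-- The partial first central moment of the binomial distribution (de Moivre's identity). -/
lemma sum_sub_mul_eval_bernsteinPolynomial {n j : ℕ} (hj : j ≤ n) (x : ℝ) :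
    ∑ k ∈ Finset.range (j + 1),
        (((n + 1 : ℕ) : ℝ) * x - k) * (bernsteinPolynomial ℝ (n + 1) k).eval x =
      (n + 1 : ℕ) * x * (1 - x) * (bernsteinPolynomial ℝ n j).eval x := by
  induction j with
  | zero => simp [eval_bernsteinPolynomial]; ring
  | succ j ih =>
    rw [Finset.sum_range_succ, ih (by omega)]
    obtain ⟨m, rfl⟩ := Nat.exists_eq_add_of_le hj
    have h₁ : ((j + 1 + m + 1 : ℕ) : ℝ) * ((j + 1 + m).choose j : ℝ) =
        ((j + 1 + m + 1).choose (j + 1) : ℝ) * (j + 1 : ℕ) := by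
      exact_mod_cast Nat.add_one_mul_choose_eq (j + 1 + m) j
    have h₂ : ((j + 1 + m + 1).choose (j + 1) : ℝ) =
        (j + 1 + m).choose j + (j + 1 + m).choose (j + 1) := by
      exact_mod_cast Nat.choose_succ_succ (j + 1 + m) j
    have e₁ : j + 1 + m + 1 - (j + 1) = m + 1 := by omega
    have e₂ : j + 1 + m - j = m + 1 := by omega
    have e₃ : j + 1 + m - (j + 1) = m := by omega
    simp only [eval_bernsteinPolynomial, e₁, e₂, e₃]
    rw [h₂] at h₁ ⊢
    push_cast at h₁ ⊢
    linear_combination x ^ (j + 1) * (1 - x) ^ (m + 1) * h₁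

lemma sq_mul_eval_bernsteinPolynomial_le {n j : ℕ} (hj : j ≤ n) {x : ℝ}
    (hx : x ∈ Icc (0 : ℝ) 1) :
    ((n + 1 : ℕ) * x * (1 - x) * (bernsteinPolynomial ℝ n j).eval x) ^ 2 ≤
      (n + 1 : ℕ) * x * (1 - x) := by
  rw [← sum_sub_mul_eval_bernsteinPolynomial hj]
  have hb := fun k => eval_bernsteinPolynomial_nonneg (n + 1) k hx
  have hsub : Finset.range (j + 1) ⊆ Finset.range (n + 1 + 1) :=
    Finset.range_subset_range.2 (by omega)
  refine (Finset.sum_sq_le_sum_mul_sum_of_sq_le_mul _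
    (f := fun k : ℕ => (((n + 1 : ℕ) : ℝ) * x - k) ^ 2 * (bernsteinPolynomial ℝ (n + 1) k).eval x)
    (g := fun k : ℕ => (bernsteinPolynomial ℝ (n + 1) k).eval x)
    (fun k _ => mul_nonneg (sq_nonneg _) (hb k)) (fun k _ => hb k) (fun k _ => by ring_nf; rfl)).trans ?_
  rw [← sum_sq_mul_eval_bernsteinPolynomial (n + 1) x]
  refine (mul_le_mul (Finset.sum_le_sum_of_subset_of_nonneg hsub
      fun k _ _ => mul_nonneg (sq_nonneg _) (hb k))
    ((Finset.sum_le_sum_of_subset_of_nonneg hsub fun k _ _ => hb k).trans_eq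
      (sum_eval_bernsteinPolynomial (n + 1) x))
    (Finset.sum_nonneg fun k _ => hb k)
    (Finset.sum_nonneg fun k _ => mul_nonneg (sq_nonneg _) (hb k))).trans_eq (mul_one _)

lemma eval_bernsteinPolynomial_le_inv_sqrt {n j : ℕ} (hj : j ≤ n) {x : ℝ}
    (hx : x ∈ Ioo (0 : ℝ) 1) :
    (bernsteinPolynomial ℝ n j).eval x ≤ (√((n + 1 : ℕ) * (x * (1 - x))))⁻¹ := by
  have hv : 0 < ((n + 1 : ℕ) : ℝ) * (x * (1 - x)) :=
    mul_pos (by positivity) (mul_pos hx.1 (sub_pos.2 hx.2))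
  have h := sq_mul_eval_bernsteinPolynomial_le hj (Ioo_subset_Icc_self hx)
  rw [mul_assoc _ x] at h
  rw [← Real.sqrt_inv]
  apply Real.le_sqrt_of_sq_le
  rw [mul_pow, sq (_ * _), mul_assoc] at h
  rw [inv_eq_one_div, le_div_iff₀' hv]
  exact le_of_mul_le_mul_left (h.trans_eq (mul_one _).symm) hv

lemma tendsto_inv_sqrt_mul {c : ℝ} (hc : 0 < c) :
    Tendsto (fun n : ℕ => (√((n + 1 : ℕ) * c))⁻¹) atTop (nhds 0) :=
  (Real.tendsto_sqrt_atTop.comp (((tendsto_natCast_atTop_atTop (R := ℝ)).comp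
    (tendsto_add_atTop_nat 1)).atTop_mul_const hc)).inv_tendsto_atTop

/-- If `f` is at most `δ` off a finite set and at most `1` on it, then the Bernstein
polynomials of `f` exceed `δ` by at most a multiple of the largest binomial weight. -/
lemma bern_le_add_card_mul {f : ℝ → ℝ} {δ : ℝ} (hδ : 0 ≤ δ) (F : Finset ℝ)
    (hF : ∀ y ∈ F, f y ≤ 1) (hFc : ∀ y ∉ F, f y ≤ δ) {n : ℕ} (hn : n ≠ 0) {x : ℝ}
    (hx : x ∈ Ioo (0 : ℝ) 1) :
    bern f n x ≤ δ + F.card * (√((n + 1 : ℕ) * (x * (1 - x))))⁻¹ := by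
  classical
  have hb := fun k => eval_bernsteinPolynomial_nonneg n k (Ioo_subset_Icc_self hx)
  set M := (√((n + 1 : ℕ) * (x * (1 - x))))⁻¹ with hM
  have hM0 : 0 ≤ M := by positivity
  set S := (Finset.range (n + 1)).filter fun k : ℕ => (k : ℝ) / n ∈ F
  have hS : S.card ≤ F.card := by
    refine Finset.card_le_card_of_injOn (fun k : ℕ => (k : ℝ) / n)
      (fun k hk => (Finset.mem_filter.1 hk).2) fun a _ b _ hab => ?_
    have hn' : (n : ℝ) ≠ 0 := Nat.cast_ne_zero.2 hn
    exact Nat.cast_injective ((div_left_inj' hn').1 hab)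
  calc bern f n x
      ≤ ∑ k ∈ Finset.range (n + 1), (δ * (bernsteinPolynomial ℝ n k).eval x +
          if (k : ℝ) / n ∈ F then M else 0) := by
        refine Finset.sum_le_sum fun k hk => ?_
        rw [mul_assoc, mul_assoc, ← mul_assoc (n.choose k : ℝ), ← eval_bernsteinPolynomial]
        split_ifs with h
        · have h₁ := mul_le_mul_of_nonneg_right (hF _ h) (hb k)
          have h₂ := eval_bernsteinPolynomial_le_inv_sqrt
            (Nat.lt_succ_iff.1 (Finset.mem_range.1 hk)) hx
          have h₃ := mul_nonneg hδ (hb k)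
          linarith
        · simpa using mul_le_mul_of_nonneg_right (hFc _ h) (hb k)
    _ = δ + S.card * M := by
        rw [Finset.sum_add_distrib, ← Finset.mul_sum, sum_eval_bernsteinPolynomial, mul_one,
          ← Finset.sum_filter, Finset.sum_const, nsmul_eq_mul]
    _ ≤ δ + F.card * M := by gcongr

lemma bern_nonneg {f : ℝ → ℝ} (hf : ∀ y, 0 ≤ f y) (n : ℕ) {x : ℝ} (hx : x ∈ Icc (0 : ℝ) 1) :
    0 ≤ bern f n x := by
  have := hx.1
  have := sub_nonneg.2 hx.2
  exact Finset.sum_nonneg fun k _ => by have := hf (k / n); positivity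

/-- Bernstein polynomials of a `[0, 1]`-valued function with finite superlevel sets tend to zero. -/
lemma tendsto_bern_zero {f : ℝ → ℝ} (hf₀ : ∀ y, 0 ≤ f y) (hf₁ : ∀ y, f y ≤ 1)
    (hfin : ∀ δ > 0, {y | δ < f y}.Finite) {x : ℝ} (hx : x ∈ Ioo (0 : ℝ) 1) :
    Tendsto (fun n => bern f n x) atTop (nhds 0) := by
  refine Metric.tendsto_nhds.2 fun ε hε => ?_
  have hfinite := hfin (ε / 2) (half_pos hε)
  have hlim := (tendsto_inv_sqrt_mul (mul_pos hx.1 (sub_pos.2 hx.2))).const_mul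
    (hfinite.toFinset.card : ℝ)
  rw [mul_zero] at hlim
  filter_upwards [hlim.eventually_lt_const (half_pos hε), eventually_ne_atTop 0] with n hn hn₀
  have h := bern_le_add_card_mul (half_pos hε).le hfinite.toFinset (fun y _ => hf₁ y)
    (fun y hy => by simpa using hy) hn₀ hx
  rw [Real.dist_0_eq_abs, abs_of_nonneg (bern_nonneg hf₀ n (Ioo_subset_Icc_self hx))]
  linarith

theorem stmt14 (A : Set ℝ) (hA : A ⊆ Set.Icc 0 1) (H : ℝ → ℕ)
    (hH : ∀ n : ℕ, {x ∈ A | H x < n}.Finite) (g : ℝ → ℝ)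
    (hg1 : ∀ x ∈ A, g x = 1 / 2 ^ (H x + 1))
    (hg2 : ∀ x ∉ A, g x = 0) :
    (∀ x ∈ Set.Ioo (0:ℝ) 1,
      Filter.Tendsto (fun n => bern g n x) Filter.atTop (nhds 0)) ∧
    (∀ x ∈ A ∩ Set.Ioo (0:ℝ) 1,
      ¬ Filter.Tendsto (fun n => bern g n x) Filter.atTop (nhds (g x))) := by
  have hpos : ∀ y ∈ A, 0 < g y := fun y hy => by rw [hg1 y hy]; positivity
  have hg₀ : ∀ y, 0 ≤ g y := fun y => by
    by_cases hy : y ∈ A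
    · exact (hpos y hy).le
    · exact (hg2 y hy).ge
  have hg₁ : ∀ y, g y ≤ 1 := fun y => by
    by_cases hy : y ∈ A
    · rw [hg1 y hy, one_div]
      exact inv_le_one_of_one_le₀ (one_le_pow₀ one_le_two)
    · rw [hg2 y hy]
      exact zero_le_one
  have hfin : ∀ δ > 0, {y | δ < g y}.Finite := fun δ hδ => by
    obtain ⟨N, hN⟩ := exists_pow_lt_of_lt_one hδ (one_half_lt_one (α := ℝ))
    refine (hH N).subset fun y hy => ?_
    have hy' : δ < g y := hy
    have hyA : y ∈ A := by
      by_contra h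
      rw [hg2 y h] at hy'
      exact hδ.not_gt hy'
    refine ⟨hyA, ?_⟩
    rw [hg1 y hyA, ← one_div_pow] at hy'
    have := (pow_lt_pow_iff_right_of_lt_one₀ (one_half_pos (α := ℝ)) one_half_lt_one).1
      (hN.trans hy')
    omega
  have hlim := fun x (hx : x ∈ Ioo (0 : ℝ) 1) => tendsto_bern_zero hg₀ hg₁ hfin hx
  exact ⟨hlim, fun x hx h => (hpos x hx.1).ne' (tendsto_nhds_unique h (hlim x hx.2))⟩
end

section
/- (Vitali–Lebesgue, one direction) Let f : [0,1] → ℝ be Riemann integrable. Then the set of points of [0,1] at which f is continuous has Lebesgue measure 1. -/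
open Filter Set MeasureTheory

/-- Riemann sum of `f` for the tagged partition given by points `x 0, …, x m` and tags `t`. -/
noncomputable def riemannSum (f : ℝ → ℝ) (m : ℕ) (x t : ℕ → ℝ) : ℝ :=
  ∑ i ∈ Finset.range m, f (t i) * (x (i + 1) - x i)

/-- `f` is Riemann integrable on `[0,1]` with integral `I`. -/
def RiemannIntegrableTo (f : ℝ → ℝ) (I : ℝ) : Prop :=
  ∀ ε > (0:ℝ), ∃ δ > (0:ℝ), ∀ (m : ℕ) (x t : ℕ → ℝ),
    x 0 = 0 → x m = 1 →
    (∀ i < m, x i ≤ t i ∧ t i ≤ x (i + 1)) →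
    (∀ i < m, x (i + 1) - x i < δ) →
    |riemannSum f m x t - I| < ε

/-- `f` is Riemann integrable on `[0,1]`. -/
def RiemannIntegrable (f : ℝ → ℝ) : Prop :=
  ∃ I : ℝ, RiemannIntegrableTo f I

/-- The points of `[0,1]` arbitrarily close to which `f` varies by at least `c`. -/
def largeOscillationSet (f : ℝ → ℝ) (c : ℝ) : Set ℝ :=
  {x ∈ Icc (0:ℝ) 1 | ∀ η > 0, ∃ y z, |y - x| < η ∧ |z - x| < η ∧ c ≤ f y - f z}

/-- The indices of the cells of the uniform partition of `[0,1]` into `N` cells on which `f`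
varies by at least `c`. -/
noncomputable def largeVariationCells (f : ℝ → ℝ) (c : ℝ) (N : ℕ) : Finset ℕ :=
  open scoped Classical in
  {i ∈ Finset.range N | ∃ s ∈ Icc (i / N : ℝ) ((i + 1) / N), ∃ t ∈ Icc (i / N : ℝ) ((i + 1) / N),
    c ≤ f s - f t}

theorem largeOscillationSet_subset (f : ℝ → ℝ) (c : ℝ) {N : ℕ} (hN : 0 < N) :
    largeOscillationSet f c ⊆ range (fun i : ℕ => (i / N : ℝ)) ∪
      ⋃ i ∈ largeVariationCells f c N, Icc (i / N : ℝ) ((i + 1) / N) := by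
  rintro x ⟨⟨hx0, hx1⟩, hx⟩
  by_cases hr : x ∈ range (fun i : ℕ => (i / N : ℝ))
  · exact Or.inl hr
  right
  have hN' : (0:ℝ) < N := by exact_mod_cast hN
  have hne (i : ℕ) : (i / N : ℝ) ≠ x := fun h => hr ⟨i, h⟩
  have hx1' : x < 1 := lt_of_le_of_ne hx1 fun h => hne N (by rw [h, div_self hN'.ne'])
  set i := ⌊x * N⌋₊
  have hlow : (i / N : ℝ) < x := by
    refine lt_of_le_of_ne ?_ (hne i)
    rw [div_le_iff₀ hN']
    exact Nat.floor_le (by positivity)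
  have hup : x < (i + 1) / N := by
    rw [lt_div_iff₀ hN']
    exact Nat.lt_floor_add_one _
  have hiN : i < N := by
    have h : (i : ℝ) < N := by
      rw [div_lt_iff₀ hN'] at hlow
      nlinarith
    exact_mod_cast h
  obtain ⟨y, z, hy, hz, hyz⟩ :=
    hx (min (x - i / N) ((i + 1) / N - x)) (lt_min (by linarith) (by linarith))
  rw [lt_min_iff, abs_lt, abs_lt] at hy hz
  simp only [mem_iUnion, exists_prop]
  refine ⟨i, ?_, hlow.le, hup.le⟩
  simp only [largeVariationCells, Finset.mem_filter, Finset.mem_range]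
  exact ⟨hiN, y, ⟨by linarith, by linarith⟩, z, ⟨by linarith, by linarith⟩, hyz⟩

theorem RiemannIntegrable.exists_card_largeVariationCells_lt {f : ℝ → ℝ}
    (hf : RiemannIntegrable f) {c ε : ℝ} (hc : 0 < c) (hε : 0 < ε) :
    ∃ N : ℕ, 0 < N ∧ ((largeVariationCells f c N).card : ℝ) / N < ε := by
  classical
  obtain ⟨I, hI⟩ := hf
  obtain ⟨δ, hδ, h⟩ := hI (c * ε / 2) (by positivity)
  obtain ⟨n, hn⟩ := exists_nat_one_div_lt hδ
  set N := n + 1 with hNdef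
  have hN' : (0:ℝ) < N := by positivity
  have hwidth (i : ℕ) : ((i + 1 : ℕ) : ℝ) / N - i / N = 1 / N := by push_cast; ring
  have htags (i : ℕ) : ∃ s t, s ∈ Icc (i / N : ℝ) ((i + 1) / N) ∧
      t ∈ Icc (i / N : ℝ) ((i + 1) / N) ∧ 0 ≤ f s - f t ∧
      (i ∈ largeVariationCells f c N → c ≤ f s - f t) := by
    by_cases hi : i ∈ largeVariationCells f c N
    · obtain ⟨-, s, hs, t, ht, hst⟩ := by
        simpa only [largeVariationCells, Finset.mem_filter] using hi
      exact ⟨s, t, hs, ht, hc.le.trans hst, fun _ => hst⟩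
    · have hmem : (i / N : ℝ) ∈ Icc (i / N : ℝ) ((i + 1) / N) :=
        ⟨le_rfl, by gcongr; linarith⟩
      exact ⟨i / N, i / N, hmem, hmem, by simp, fun h => absurd h hi⟩
  choose s t hs ht hst0 hst using htags
  have hsum (u : ℕ → ℝ) (hu : ∀ i : ℕ, u i ∈ Icc (i / N : ℝ) ((i + 1) / N)) :
      |riemannSum f N (fun i => i / N) u - I| < c * ε / 2 := by
    refine h N _ u (by simp) (div_self hN'.ne') (fun i _ => ?_) (fun i _ => ?_)
    · simpa using hu i
    · simp only [hwidth]
      simpa [hNdef] using hn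
  have hS := abs_lt.1 (hsum s hs)
  have hT := abs_lt.1 (hsum t ht)
  have hdiff : riemannSum f N (fun i => i / N) s - riemannSum f N (fun i => i / N) t =
      ∑ i ∈ Finset.range N, (f (s i) - f (t i)) * (1 / N) := by
    simp only [riemannSum, hwidth, ← Finset.sum_sub_distrib, sub_mul]
  have hcard : (largeVariationCells f c N).card * (c * (1 / N)) ≤
      ∑ i ∈ Finset.range N, (f (s i) - f (t i)) * (1 / N) := by
    calc _ = ∑ i ∈ largeVariationCells f c N, c * (1 / (N : ℝ)) := by simp
      _ ≤ ∑ i ∈ largeVariationCells f c N, (f (s i) - f (t i)) * (1 / N) :=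
        Finset.sum_le_sum fun i hi => by gcongr; exact hst i hi
      _ ≤ _ := Finset.sum_le_sum_of_subset_of_nonneg (Finset.filter_subset _ _)
        fun i _ _ => mul_nonneg (hst0 i) (by positivity)
  refine ⟨N, n.succ_pos, lt_of_mul_lt_mul_left ?_ hc.le⟩
  calc c * ((largeVariationCells f c N).card / N)
      = (largeVariationCells f c N).card * (c * (1 / N)) := by ring
    _ < c * ε := by linarith

theorem RiemannIntegrable.volume_largeOscillationSet {f : ℝ → ℝ} (hf : RiemannIntegrable f)
    {c : ℝ} (hc : 0 < c) : volume (largeOscillationSet f c) = 0 := by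
  refine le_antisymm (ENNReal.le_of_forall_pos_le_add fun ε hε _ => ?_) zero_le
  obtain ⟨N, hN, hlt⟩ := hf.exists_card_largeVariationCells_lt hc (NNReal.coe_pos.2 hε)
  have hcell (i : ℕ) : volume (Icc (i / N : ℝ) ((i + 1) / N)) = ENNReal.ofReal (1 / N) := by
    rw [Real.volume_Icc]
    congr 1
    ring
  rw [zero_add]
  calc volume (largeOscillationSet f c)
      ≤ volume (range (fun i : ℕ => (i / N : ℝ))) +
          volume (⋃ i ∈ largeVariationCells f c N, Icc (i / N : ℝ) ((i + 1) / N)) :=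
        (measure_mono (largeOscillationSet_subset f c hN)).trans (measure_union_le _ _)
    _ ≤ 0 + ∑ i ∈ largeVariationCells f c N, volume (Icc (i / N : ℝ) ((i + 1) / N)) := by
        gcongr
        · exact ((countable_range _).measure_zero _).le
        · exact measure_biUnion_finset_le _ _
    _ = ENNReal.ofReal ((largeVariationCells f c N).card / N) := by
        simp only [hcell, Finset.sum_const, zero_add]
        rw [← ENNReal.ofReal_nsmul, nsmul_eq_mul, mul_one_div]
    _ ≤ ε := ENNReal.ofReal_le_of_le_toReal hlt.le

theorem exists_mem_largeOscillationSet {f : ℝ → ℝ} {x : ℝ} (hx : x ∈ Icc (0:ℝ) 1)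
    (h : ¬ ContinuousWithinAt f (Icc 0 1) x) :
    ∃ n : ℕ, x ∈ largeOscillationSet f (1 / (n + 1)) := by
  rw [Metric.continuousWithinAt_iff] at h
  push Not at h
  obtain ⟨ε, hε, h⟩ := h
  obtain ⟨n, hn⟩ := exists_nat_one_div_lt hε
  refine ⟨n, hx, fun η hη => ?_⟩
  obtain ⟨y, -, hyx, hfy⟩ := h η hη
  rw [Real.dist_eq] at hyx hfy
  have hxx : |x - x| < η := by simpa using hη
  rcases le_abs.1 hfy with hfy | hfy
  · exact ⟨y, x, hyx, hxx, by linarith⟩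
  · exact ⟨x, y, hxx, hyx, by linarith⟩

theorem stmt16 (f : ℝ → ℝ) (hf : RiemannIntegrable f) :
    volume {x ∈ Set.Icc (0:ℝ) 1 | ContinuousWithinAt f (Set.Icc 0 1) x} = 1 := by
  have hnull : volume {x ∈ Icc (0:ℝ) 1 | ¬ ContinuousWithinAt f (Icc 0 1) x} = 0 := by
    refine measure_mono_null (t := ⋃ n : ℕ, largeOscillationSet f (1 / (n + 1))) ?_ ?_
    · exact fun x hx => mem_iUnion.2 (exists_mem_largeOscillationSet hx.1 hx.2)
    · exact measure_iUnion_null fun n => hf.volume_largeOscillationSet (by positivity)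
  have heq : {x ∈ Icc (0:ℝ) 1 | ContinuousWithinAt f (Icc 0 1) x} =
      Icc (0:ℝ) 1 \ {x ∈ Icc (0:ℝ) 1 | ¬ ContinuousWithinAt f (Icc 0 1) x} := by
    ext x
    simp only [mem_ofPred_eq, Set.mem_sdiff]
    tauto
  rw [heq, measure_sdiff_null hnull, Real.volume_Icc]
  simp
end

section
/- Let f : [0,1] → ℝ be upper semicontinuous, i.e. limsup_{y→x} f(y) ≤ f(x) for every x ∈ [0,1]. Then there exists a point of [0,1] at which f is continuous. -/
open Filter Set

/-- An upper semicontinuous real function is continuous at the points of a residual set: it is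
continuous off the frontiers of its closed superlevel sets at rational heights. -/
theorem UpperSemicontinuous.eventually_residual_continuousAt {X : Type*} [TopologicalSpace X]
    {g : X → ℝ} (hg : UpperSemicontinuous g) : ∀ᶠ x in residual X, ContinuousAt g x := by
  have hclosed (q : ℚ) : IsClosed (g ⁻¹' Ici (q : ℝ)) := hg.isClosed_preimage q
  have hfrontier : ∀ᶠ x in residual X, ∀ q : ℚ, x ∉ frontier (g ⁻¹' Ici (q : ℝ)) :=
    eventually_countable_forall.2 fun q ↦
      residual_of_dense_open isClosed_frontier.isOpen_compl
        (interior_eq_empty_iff_dense_compl.1 (interior_frontier (hclosed q)))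
  filter_upwards [hfrontier] with x hx
  refine continuousAt_iff_lower_upperSemicontinuousAt.2 ⟨fun a ha ↦ ?_, hg x⟩
  obtain ⟨q, haq, hqx⟩ := exists_rat_btwn ha
  have hmem : x ∈ interior (g ⁻¹' Ici (q : ℝ)) := by
    by_contra h
    exact hx q ⟨subset_closure hqx.le, h⟩
  filter_upwards [mem_interior_iff_mem_nhds.1 hmem] with y hy
  exact haq.trans_le hy

theorem stmt18 (f : ℝ → ℝ) (hf : UpperSemicontinuousOn f (Set.Icc 0 1)) :
    ∃ x ∈ Set.Icc (0:ℝ) 1, ContinuousWithinAt f (Set.Icc 0 1) x := by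
  have hg : UpperSemicontinuous ((Icc (0 : ℝ) 1).domRestrict f) :=
    upperSemicontinuousOn_iff_restrict.2 hf
  obtain ⟨x, hx⟩ := (dense_of_mem_residual hg.eventually_residual_continuousAt).nonempty
  exact ⟨x, x.2, (continuousWithinAt_iff_continuousAt_domRestrict f x.2).2 hx⟩
end

section
/- Let (X_n)_{n∈ℕ} be an increasing sequence (X_n ⊆ X_{n+1}) of closed subsets of [0,1], each of Lebesgue measure zero. Define h : [0,1] → ℝ by h(x) := 2^{−(n+1)} where n is the least index with x ∈ X_n, and h(x) := 0 if x ∉ ⋃_{n∈ℕ} X_n. Then h is Riemann integrable on [0,1] with Riemann integral 0. -/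
open Filter Set MeasureTheory

/-- A bounded nonnegative function which, for every `c > 0`, is at most `c` outside some compact
null set is Riemann integrable on `[0,1]` with integral `0`. -/
theorem riemannIntegrableTo_zero_of_le_off_compact_null {f : ℝ → ℝ} {C : ℝ}
    (hf0 : ∀ y, 0 ≤ f y) (hfC : ∀ y, f y ≤ C)
    (hf : ∀ c > 0, ∃ K : Set ℝ, IsCompact K ∧ volume K = 0 ∧ ∀ y ∉ K, f y ≤ c) :
    RiemannIntegrableTo f 0 := by
  intro ε hε
  have hC : 0 ≤ C := (hf0 0).trans (hfC 0)
  obtain ⟨K, hK, hK0, hfK⟩ := hf (ε / 2) (by positivity)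
  have hη : 0 < ε / (2 * (C + 1)) := by positivity
  obtain ⟨U, hKU, hUo, hUv⟩ := K.exists_isOpen_lt_of_lt (μ := volume)
    (ENNReal.ofReal (ε / (2 * (C + 1)))) (by rw [hK0]; exact ENNReal.ofReal_pos.2 hη)
  obtain ⟨δ, hδ, hthick⟩ := hK.exists_thickening_subset_open hUo hKU
  refine ⟨δ, hδ, fun m x t hx0 hxm ht hmesh => ?_⟩
  have hstep : ∀ i < m, x i ≤ x (i + 1) := fun i hi => (ht i hi).1.trans (ht i hi).2
  set g : ℝ → ℝ := fun y => U.indicator (fun _ => C) y + ε / 2 with hg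
  have hind : ∀ a b, IntervalIntegrable (U.indicator fun _ => C) volume a b := fun a b =>
    ⟨(integrableOn_const (by simp)).indicator hUo.measurableSet,
      (integrableOn_const (by simp)).indicator hUo.measurableSet⟩
  have hgint : ∀ a b, IntervalIntegrable g volume a b := fun a b =>
    (hind a b).add intervalIntegrable_const
  have hterm : ∀ i < m, f (t i) * (x (i + 1) - x i) ≤ ∫ y in x i..x (i + 1), g y := by
    intro i hi
    calc f (t i) * (x (i + 1) - x i) = ∫ _ in x i..x (i + 1), f (t i) := by
          rw [intervalIntegral.integral_const, smul_eq_mul, mul_comm]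
      _ ≤ _ := by
          refine intervalIntegral.integral_mono_on (hstep i hi) intervalIntegrable_const
            (hgint _ _) fun y hy => ?_
          by_cases htK : t i ∈ K
          · have hyU : y ∈ U := hthick <| Metric.mem_thickening_iff.2 ⟨t i, htK, by
              have := ht i hi
              have := hmesh i hi
              rw [Real.dist_eq, abs_lt]
              constructor <;> linarith [hy.1, hy.2]⟩
            simp only [hg, indicator_of_mem hyU]
            linarith [hfC (t i)]
          · have : 0 ≤ U.indicator (fun _ => C) y := indicator_nonneg (fun _ _ => hC) y
            simp only [hg]
            linarith [hfK _ htK]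
  have hupper : riemannSum f m x t ≤ ∫ y in (0 : ℝ)..1, g y := by
    rw [← hx0, ← hxm, ← intervalIntegral.sum_integral_adjacent_intervals fun i _ => hgint _ _]
    exact Finset.sum_le_sum fun i hi => hterm i (Finset.mem_range.1 hi)
  have hlower : 0 ≤ riemannSum f m x t := Finset.sum_nonneg fun i hi =>
    mul_nonneg (hf0 _) (sub_nonneg.2 (hstep i (Finset.mem_range.1 hi)))
  have hvol : volume.real (U ∩ Ioc 0 1) ≤ ε / (2 * (C + 1)) :=
    ENNReal.toReal_le_of_le_ofReal hη.le ((measure_mono inter_subset_left).trans hUv.le)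
  have hval : ∫ y in (0 : ℝ)..1, g y = volume.real (U ∩ Ioc 0 1) * C + ε / 2 := by
    rw [hg, intervalIntegral.integral_add (hind 0 1) intervalIntegrable_const,
      intervalIntegral.integral_of_le zero_le_one, integral_indicator_const _ hUo.measurableSet,
      measureReal_restrict_apply hUo.measurableSet]
    simp
  have hlt : ε / (2 * (C + 1)) * C < ε / 2 := by
    rw [div_mul_eq_mul_div, div_lt_div_iff₀ (by positivity) two_pos]
    nlinarith
  rw [sub_zero, abs_of_nonneg hlower]
  linarith [mul_le_mul_of_nonneg_right hvol hC]

theorem stmt19 (X : ℕ → Set ℝ) (hXsub : ∀ n, X n ⊆ Set.Icc 0 1)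
    (hXclosed : ∀ n, IsClosed (X n)) (hXmono : ∀ n, X n ⊆ X (n + 1))
    (hXnull : ∀ n, volume (X n) = 0) (h : ℝ → ℝ)
    (hh1 : ∀ (x : ℝ) (n : ℕ), x ∈ X n → (∀ m < n, x ∉ X m) → h x = 1 / 2 ^ (n + 1))
    (hh2 : ∀ x, x ∉ ⋃ n, X n → h x = 0) :
    RiemannIntegrableTo h 0 := by
  have hmono : Monotone X := monotone_nat_of_le_succ hXmono
  have hcases : ∀ y, h y = 0 ∨ ∃ n, y ∈ X n ∧ h y = (1 / 2) ^ (n + 1) := by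
    classical
    intro y
    by_cases hy : ∃ n, y ∈ X n
    · refine Or.inr ⟨Nat.find hy, Nat.find_spec hy, ?_⟩
      rw [hh1 y _ (Nat.find_spec hy) fun m hm => Nat.find_min hy hm, one_div_pow]
    · exact Or.inl (hh2 y (by simpa using hy))
  refine riemannIntegrableTo_zero_of_le_off_compact_null (C := 1) (fun y => ?_) (fun y => ?_)
    fun c hc => ?_
  · obtain h0 | ⟨n, -, hn⟩ := hcases y
    · exact h0.ge
    · rw [hn]
      positivity
  · obtain h0 | ⟨n, -, hn⟩ := hcases y
    · exact h0.le.trans zero_le_one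
    · rw [hn]
      exact pow_le_one₀ (by norm_num) (by norm_num)
  · obtain ⟨N, hN⟩ := exists_pow_lt_of_lt_one hc (one_half_lt_one (α := ℝ))
    refine ⟨X N, isCompact_Icc.of_isClosed_subset (hXclosed N) (hXsub N), hXnull N,
      fun y hy => ?_⟩
    obtain h0 | ⟨n, hyn, hn⟩ := hcases y
    · exact h0.le.trans hc.le
    · have hNn : N ≤ n := le_of_not_ge fun hle => hy (hmono hle hyn)
      rw [hn]
      exact (pow_le_pow_of_le_one (by norm_num) (by norm_num) (by lia)).trans hN.le
end
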